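/- Let ρ : ((Π i : Fin d, E^i) → ℂ) → (E → ℂ) be the linear map defined by ρ(f)(i,e) := Σ_{p with p i = e} f(p). Then the image under ρ of the ℂ-linear span of the path tensors {ψ(i,e) : i ∈ Fin d, e ∈ E^i} equals the flow space F of Γ̃. In particular, the dimension of the span of the path tensors is at least dim F = |E| − (Σ_{i ∈ Fin d} w i) + 1. -/

import Mathlib

open scoped BigOperators

attribute [local instance] Classical.propDecidable

namespace ABP

variable {d : ℕ} [NeZero d]

/-- The set of edges in layer `i` of a (cyclic / trace) ABP of width format `w`:
an edge `(a, b)` goes from vertex `a` of layer `i` to vertex `b` of layer `i + 1`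
(layer indices modulo `d`). -/
abbrev Edge (w : Fin d → ℕ) (i : Fin d) : Type := Fin (w i) × Fin (w (i + 1))

/-- An edge tuple is a valid path if consecutive edges match (cyclically). -/
def ValidPath (w : Fin d → ℕ) (p : ∀ i : Fin d, Edge w i) : Prop :=
  ∀ i : Fin d, (p i).2 = (p (i + 1)).1

/-- An edge is parity preserving if its two endpoints have the same parity. -/
def ParityPres {w : Fin d → ℕ} {i : Fin d} (e : Edge w i) : Prop :=
  e.1.val % 2 = e.2.val % 2

/-- The number of parity-preserving edges of an edge tuple. -/
noncomputable def ppCount (w : Fin d → ℕ) (p : ∀ i : Fin d, Edge w i) : ℕ :=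
  (Finset.univ.filter fun i : Fin d => ParityPres (p i)).card

/-- The tensor `f_com`: value 1 on valid paths, 0 elsewhere. -/
noncomputable def fcom (w : Fin d → ℕ) : (∀ i : Fin d, Edge w i) → ℂ :=
  fun p => if ValidPath w p then 1 else 0

/-- The tensor `f_0`: value 1 on valid paths containing exactly one
parity-preserving edge, 0 elsewhere. -/
noncomputable def f0 (w : Fin d → ℕ) : (∀ i : Fin d, Edge w i) → ℂ :=
  fun p => if ValidPath w p ∧ ppCount w p = 1 then 1 else 0

/-- The action of a tuple of matrices `g i : E^i → E^i → ℂ` on a tensor: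
`((⊗ᵢ gᵢ) f)(p) = Σ_q (Πᵢ gᵢ (p i) (q i)) · f q`. -/
noncomputable def actT (w : Fin d → ℕ) (g : ∀ i : Fin d, Edge w i → Edge w i → ℂ)
    (f : (∀ i : Fin d, Edge w i) → ℂ) : (∀ i : Fin d, Edge w i) → ℂ :=
  fun p => ∑ q : ∀ i : Fin d, Edge w i, (∏ i : Fin d, g i (p i) (q i)) * f q

end ABP

namespace ABP

/-- The path tensor `ψ(i,e)`: value 1 on valid paths whose `i`-th edge is `e`,
0 elsewhere. -/
noncomputable def psi {d : ℕ} [NeZero d] (w : Fin d → ℕ) (i : Fin d) (e : Edge w i) :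
    (∀ i : Fin d, Edge w i) → ℂ :=
  fun p => if ValidPath w p ∧ p i = e then 1 else 0

end ABP

namespace ABP

/-- A flow on the digraph `Γ̃`: a labeling of the edges by complex numbers with
conservation at every vertex. The vertex `(i+1, a)` has incoming edges
`(i, (b, a))` and outgoing edges `(i+1, (a, b'))`. -/
def IsFlow {d : ℕ} [NeZero d] (w : Fin d → ℕ) (c : (Σ i : Fin d, Edge w i) → ℂ) : Prop :=
  ∀ i : Fin d, ∀ a : Fin (w (i + 1)),
    (∑ b : Fin (w i), c ⟨i, (b, a)⟩) = ∑ b' : Fin (w (i + 1 + 1)), c ⟨i + 1, (a, b')⟩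

/-- The characteristic flow of an edge tuple `p`: value 1 on the `d` edges
`(i, p i)` and 0 on all other edges. -/
noncomputable def chi {d : ℕ} [NeZero d] (w : Fin d → ℕ) (p : ∀ i : Fin d, Edge w i) :
    (Σ i : Fin d, Edge w i) → ℂ :=
  fun ie => if p ie.1 = ie.2 then 1 else 0

end ABP

namespace ABP

/-- The linear map `ρ` sending a tensor `f` to the edge labeling
`(i,e) ↦ Σ_{p with p i = e} f(p)`. -/
noncomputable def rho {d : ℕ} [NeZero d] (w : Fin d → ℕ)
    (f : (∀ i : Fin d, Edge w i) → ℂ) : (Σ i : Fin d, Edge w i) → ℂ :=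
  fun ie => ∑ p : ∀ i : Fin d, Edge w i, if p ie.1 = ie.2 then f p else 0

end ABP


namespace ABPaux

open ABP

lemma val_one_aux {d : ℕ} [NeZero d] (hd3 : 3 ≤ d) : ((1 : Fin d) : ℕ) = 1 := by
  have h : ((1 : Fin d) : ℕ) = 1 % d := rfl
  rw [h, Nat.mod_eq_of_lt (by omega)]

lemma fin_ne1 {d : ℕ} [NeZero d] (hd3 : 3 ≤ d) (i : Fin d) : i + 1 ≠ i := by
  intro h
  have h1 : (1 : Fin d) = 0 := by simpa using h
  have h2 := congrArg Fin.val h1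
  rw [val_one_aux hd3, Fin.val_zero] at h2
  omega

lemma fin_ne2 {d : ℕ} [NeZero d] (hd3 : 3 ≤ d) (i : Fin d) : i + 1 + 1 ≠ i := by
  intro h
  have h1 : (1 + 1 : Fin d) = 0 := by
    rw [add_assoc] at h
    exact add_eq_left.mp h
  have h2 := congrArg Fin.val h1
  rw [Fin.val_add, val_one_aux hd3, Fin.val_zero, Nat.mod_eq_of_lt (by omega)] at h2
  omega

lemma sum_shift {d : ℕ} [NeZero d] {M : Type*} [AddCommMonoid M] (G : Fin d → M) :
    ∑ i, G (i + 1) = ∑ i, G i :=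
  Equiv.sum_comp (Equiv.addRight (1 : Fin d)) G

/-- Structure of functionals vanishing on all closed paths. -/
lemma phi_struct {d : ℕ} [NeZero d] (hd3 : 3 ≤ d) (w : Fin d → ℕ)
    (z : ∀ i, Fin (w i)) (φ : (Σ i : Fin d, Edge w i) → ℂ)
    (h : ∀ v : ∀ i, Fin (w i), ∑ i, φ ⟨i, (v i, v (i + 1))⟩ = 0)
    (i : Fin d) (a : Fin (w i)) (b : Fin (w (i + 1))) :
    φ ⟨i, (a, b)⟩ = φ ⟨i, (a, z _)⟩ - φ ⟨i + 1, (b, z _)⟩ + φ ⟨i + 1, (z _, z _)⟩ := by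
  have n1 := fin_ne1 hd3 i
  have n2 := fin_ne2 hd3 i
  have n3 := fin_ne1 hd3 (i + 1)
  have hmix : φ ⟨i, (a, b)⟩ - φ ⟨i, (a, z _)⟩ - φ ⟨i, (z _, b)⟩ + φ ⟨i, (z _, z _)⟩ = 0 := by
    have ab := h (Function.update (Function.update z i a) (i + 1) b)
    have ha := h (Function.update z i a)
    have hb := h (Function.update z (i + 1) b)
    have h0 := h z
    have key : ∑ j, (φ ⟨j, (Function.update (Function.update z i a) (i + 1) b j,
          Function.update (Function.update z i a) (i + 1) b (j + 1))⟩
        - φ ⟨j, (Function.update z i a j, Function.update z i a (j + 1))⟩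
        - φ ⟨j, (Function.update z (i + 1) b j, Function.update z (i + 1) b (j + 1))⟩
        + φ ⟨j, (z j, z (j + 1))⟩) = 0 := by
      rw [Finset.sum_add_distrib, Finset.sum_sub_distrib, Finset.sum_sub_distrib,
        ab, ha, hb, h0]
      ring
    rw [Finset.sum_eq_single i] at key
    · simpa [Function.update_of_ne n1, Function.update_of_ne n1.symm] using key
    · intro j _ hj
      have hz : ∀ k, k ≠ i → Function.update (Function.update z i a) (i + 1) b k
          = Function.update z (i + 1) b k := by
        intro k hk
        rw [Function.update_comm n1.symm, Function.update_of_ne hk]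
      by_cases hji : j + 1 = i
      · have e1 : j ≠ i + 1 := by
          rintro rfl
          exact n2 hji
        have e2 : j + 1 ≠ i + 1 := fun e => hj (add_right_cancel e)
        simp only [Function.update_of_ne e1, Function.update_of_ne e2]
        ring
      · rw [hz j hj, hz _ hji]
        simp only [Function.update_of_ne hj, Function.update_of_ne hji]
        ring
    · simp
  have htwo : φ ⟨i, (z _, b)⟩ + φ ⟨i + 1, (b, z _)⟩
      = φ ⟨i, (z _, z _)⟩ + φ ⟨i + 1, (z _, z _)⟩ := by
    have hb := h (Function.update z (i + 1) b)
    have h0 := h z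
    have key : ∑ j, (φ ⟨j, (Function.update z (i + 1) b j, Function.update z (i + 1) b (j + 1))⟩
        - φ ⟨j, (z j, z (j + 1))⟩) = 0 := by
      rw [Finset.sum_sub_distrib, hb, h0]
      ring
    rw [Finset.sum_eq_add i (i + 1) n1.symm] at key
    · simp [Function.update_of_ne n1.symm, Function.update_of_ne n3] at key
      linear_combination key
    · intro j _ hj
      have e2 : j + 1 ≠ i + 1 := fun e => hj.1 (add_right_cancel e)
      simp only [Function.update_of_ne hj.2, Function.update_of_ne e2]
      ring
    · simp
    · simp
  linear_combination hmix + htwo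

lemma total_const {d : ℕ} [NeZero d] (T : Fin d → ℂ) (h : ∀ i, T (i + 1) = T i) (i : Fin d) :
    T i = T 0 := by
  have : ∀ n : ℕ, T (Fin.ofNat d n) = T 0 := by
    intro n
    induction n with
    | zero => rfl
    | succ k ih =>
      rw [← ih, ← h (Fin.ofNat d k)]
      congr 1
      ext
      simp [Fin.val_add, Fin.ofNat]
  have h2 := this i.val
  simpa using h2

lemma phi_flow {d : ℕ} [NeZero d] (hd3 : 3 ≤ d) (w : Fin d → ℕ)
    (z : ∀ i, Fin (w i)) (φ : (Σ i : Fin d, Edge w i) → ℂ)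
    (h : ∀ v : ∀ i, Fin (w i), ∑ i, φ ⟨i, (v i, v (i + 1))⟩ = 0)
    (c : (Σ i : Fin d, Edge w i) → ℂ) (hc : IsFlow w c) :
    ∑ x, φ x * c x = 0 := by
  set T : Fin d → ℂ := fun i => ∑ a, ∑ b, c ⟨i, (a, b)⟩ with hT
  have hTc : ∀ i, T i = T 0 := by
    apply total_const
    intro i
    simp only [hT]
    rw [Finset.sum_comm (γ := Fin (w i))]
    exact Finset.sum_congr rfl fun a _ => (hc i a).symm
  set U : Fin d → ℂ := fun i => ∑ a, φ ⟨i, (a, z _)⟩ * ∑ b, c ⟨i, (a, b)⟩ with hU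
  have e : ∀ i : Fin d, ∑ y : Edge w i, φ ⟨i, y⟩ * c ⟨i, y⟩
      = U i - U (i + 1) + φ ⟨i + 1, (z _, z _)⟩ * T 0 := by
    intro i
    rw [← hTc i, Fintype.sum_prod_type]
    have e1 : U (i + 1) = ∑ a, ∑ b, φ ⟨i + 1, (b, z _)⟩ * c ⟨i, (a, b)⟩ := by
      rw [Finset.sum_comm]
      refine Finset.sum_congr rfl fun b _ => ?_
      rw [← hc i b, Finset.mul_sum]
    rw [e1]
    simp only [hU, hT, Finset.mul_sum, ← Finset.sum_sub_distrib, ← Finset.sum_add_distrib]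
    refine Finset.sum_congr rfl fun a _ => Finset.sum_congr rfl fun b _ => ?_
    rw [phi_struct hd3 w z φ h i a b]
    ring
  rw [Fintype.sum_sigma]
  simp only [e]
  rw [Finset.sum_add_distrib, Finset.sum_sub_distrib, sum_shift U, ← Finset.sum_mul,
    sum_shift (fun i => φ ⟨i, (z i, z (i + 1))⟩), h z]
  ring

/-- `rho` as a linear map. -/
noncomputable def rhoL {d : ℕ} [NeZero d] (w : Fin d → ℕ) :
    ((∀ i : Fin d, Edge w i) → ℂ) →ₗ[ℂ] ((Σ i : Fin d, Edge w i) → ℂ) where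
  toFun := rho w
  map_add' f g := by
    funext x
    simp only [rho, Pi.add_apply, ← Finset.sum_add_distrib]
    refine Finset.sum_congr rfl fun p _ => ?_
    split_ifs <;> simp
  map_smul' r f := by
    funext x
    simp only [rho, Pi.smul_apply, RingHom.id_apply, smul_eq_mul, Finset.mul_sum]
    refine Finset.sum_congr rfl fun p _ => ?_
    split_ifs <;> simp

/-- The divergence map. -/
noncomputable def divL {d : ℕ} [NeZero d] (w : Fin d → ℕ) :
    ((Σ i : Fin d, Edge w i) → ℂ) →ₗ[ℂ] ((Σ i : Fin d, Fin (w (i + 1))) → ℂ) where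
  toFun c := fun x => (∑ b : Fin (w x.1), c ⟨x.1, (b, x.2)⟩)
    - ∑ b' : Fin (w (x.1 + 1 + 1)), c ⟨x.1 + 1, (x.2, b')⟩
  map_add' f g := by
    funext x
    simp only [Pi.add_apply, Finset.sum_add_distrib]
    ring
  map_smul' r f := by
    funext x
    simp only [Pi.smul_apply, RingHom.id_apply, smul_eq_mul, ← Finset.mul_sum]
    ring

lemma mem_ker_divL {d : ℕ} [NeZero d] (w : Fin d → ℕ) (c : (Σ i : Fin d, Edge w i) → ℂ) :
    c ∈ LinearMap.ker (divL w) ↔ IsFlow w c := by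
  rw [LinearMap.mem_ker, funext_iff, Sigma.forall]
  simp only [divL, LinearMap.coe_mk, AddHom.coe_mk, Pi.zero_apply, sub_eq_zero]
  rfl

lemma rho_psi_flow {d : ℕ} [NeZero d] (w : Fin d → ℕ) (x : Σ i : Fin d, Edge w i) :
    IsFlow w (rho w (psi w x.1 x.2)) := by
  intro i a
  simp only [rho]
  rw [Finset.sum_comm, Finset.sum_comm (γ := Fin (w (i + 1 + 1)))]
  refine Finset.sum_congr rfl fun p _ => ?_
  by_cases hp : ValidPath w p
  · have h1 : ∀ b : Fin (w i), (p i = (b, a)) ↔ (b = (p i).1 ∧ (p i).2 = a) := by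
      intro b
      rw [Prod.ext_iff]
      exact and_congr_left fun _ => eq_comm
    have h2 : ∀ b : Fin (w (i + 1 + 1)),
        (p (i + 1) = (a, b)) ↔ (b = (p (i + 1)).2 ∧ (p i).2 = a) := by
      intro b
      rw [Prod.ext_iff, hp i, and_comm]
      exact and_congr_left fun _ => eq_comm
    simp only [h1, h2, ite_and, Finset.sum_ite_eq', Finset.mem_univ, if_true]
  · have : psi w x.1 x.2 p = 0 := by simp [psi, hp]
    simp [this]

lemma vanish {d : ℕ} [NeZero d] (w : Fin d → ℕ) (φ : (Σ i : Fin d, Edge w i) → ℂ)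
    (h : ∀ x : Σ i : Fin d, Edge w i, ∑ y, φ y * rho w (psi w x.1 x.2) y = 0)
    (p : ∀ i : Fin d, Edge w i) (hp : ValidPath w p) : ∑ i, φ ⟨i, p i⟩ = 0 := by
  set g : (∀ i : Fin d, Edge w i) → ℂ := fun p => ∑ i, φ ⟨i, p i⟩ with hg
  -- pairing with rho
  have h1 : ∀ f : (∀ i : Fin d, Edge w i) → ℂ, ∑ y, φ y * rho w f y = ∑ q, g q * f q := by
    intro f
    simp only [rho, Finset.mul_sum]
    rw [Finset.sum_comm]
    refine Finset.sum_congr rfl fun q _ => ?_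
    rw [Fintype.sum_sigma, hg, Finset.sum_mul]
    refine Finset.sum_congr rfl fun i _ => ?_
    simp [mul_ite]
  have h2 : ∀ q, ∑ x : Σ i : Fin d, Edge w i, (starRingEnd ℂ) (φ x) * psi w x.1 x.2 q
      = if ValidPath w q then (starRingEnd ℂ) (g q) else 0 := by
    intro q
    by_cases hq : ValidPath w q
    · simp only [psi, hq, true_and, if_true, hg, map_sum]
      rw [Fintype.sum_sigma]
      refine Finset.sum_congr rfl fun i _ => ?_
      simp [mul_ite]
    · simp [psi, hq]
  have h3 : ∑ q, (if ValidPath w q then g q * (starRingEnd ℂ) (g q) else 0) = 0 := by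
    have : ∑ x : Σ i : Fin d, Edge w i, (starRingEnd ℂ) (φ x) * ∑ q, g q * psi w x.1 x.2 q = 0 :=
      Finset.sum_eq_zero fun x _ => by rw [← h1, h x, mul_zero]
    refine Eq.trans ?_ this
    simp only [Finset.mul_sum]
    rw [Finset.sum_comm]
    refine Finset.sum_congr rfl fun q _ => ?_
    have h4 := congrArg (fun t => g q * t) (h2 q)
    simp only [mul_ite, mul_zero, Finset.mul_sum] at h4
    rw [← h4]
    refine Finset.sum_congr rfl fun x _ => ?_
    ring
  have h5 : ∑ q, (if ValidPath w q then Complex.normSq (g q) else 0) = 0 := by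
    have := congrArg Complex.re h3
    rw [Complex.re_sum] at this
    rw [Complex.zero_re] at this
    refine Eq.trans ?_ this
    refine Finset.sum_congr rfl fun q _ => ?_
    split_ifs
    · rw [Complex.mul_conj, Complex.ofReal_re]
    · rfl
  rw [Finset.sum_eq_zero_iff_of_nonneg] at h5
  · have := h5 p (Finset.mem_univ _)
    rw [if_pos hp] at this
    exact Complex.normSq_eq_zero.mp this
  · intro q _
    split_ifs
    · exact Complex.normSq_nonneg _
    · exact le_rfl

lemma map_eq {d : ℕ} [NeZero d] (hd3 : 3 ≤ d) (w : Fin d → ℕ) (hw : ∀ i, 2 ≤ w i) :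
    (Submodule.span ℂ (Set.range fun x : Σ i : Fin d, Edge w i => psi w x.1 x.2)).map (rhoL w)
      = LinearMap.ker (divL w) := by
  apply le_antisymm
  · rw [Submodule.map_span_le]
    rintro _ ⟨x, rfl⟩
    rw [mem_ker_divL]
    exact rho_psi_flow w x
  · intro c hc
    rw [mem_ker_divL] at hc
    by_contra hn
    obtain ⟨f, hf, hle⟩ := Submodule.exists_le_ker_of_notMem hn
    let z : ∀ i, Fin (w i) := fun i => ⟨0, by have := hw i; omega⟩
    have hrep : ∀ y : (Σ i : Fin d, Edge w i) → ℂ,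
        f y = ∑ x, f (Pi.single x 1) * y x := by
      intro y
      conv_lhs => rw [LinearMap.pi_apply_eq_sum_univ f y]
      refine Finset.sum_congr rfl fun x _ => ?_
      rw [smul_eq_mul, mul_comm]
      congr 2
      funext t
      simp [Pi.single_apply, eq_comm]
    apply hf
    rw [hrep]
    refine phi_flow hd3 w z (fun x => f (Pi.single x 1)) ?_ c hc
    intro v
    refine vanish w (fun x => f (Pi.single x 1)) ?_ (fun i => (v i, v (i + 1))) (fun i => rfl)
    intro x
    rw [← hrep]
    exact hle (Submodule.mem_map_of_mem (f := rhoL w) (Submodule.subset_span ⟨x, rfl⟩))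

lemma dim_flow {d : ℕ} [NeZero d] (w : Fin d → ℕ) (hw : ∀ i, 2 ≤ w i) :
    (∑ i : Fin d, w i * w (i + 1)) - (∑ i : Fin d, w i) + 1 ≤
      Module.finrank ℂ (LinearMap.ker (divL w)) := by
  let s : ((Σ i : Fin d, Fin (w (i + 1))) → ℂ) →ₗ[ℂ] ℂ := ∑ x, LinearMap.proj x
  have hs : ∀ f, s f = ∑ x, f x := by
    intro f
    simp [s]
  have hrn := LinearMap.finrank_range_add_finrank_ker (divL w)
  have hsn := LinearMap.finrank_range_add_finrank_ker s
  have hsurj : LinearMap.range s = ⊤ := by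
    apply LinearMap.range_eq_top.mpr
    intro r
    refine ⟨Pi.single ⟨0, ⟨0, by have := hw (0 + 1); omega⟩⟩ r, ?_⟩
    rw [hs]
    simp
  have hle : LinearMap.range (divL w) ≤ LinearMap.ker s := by
    rintro _ ⟨c, rfl⟩
    rw [LinearMap.mem_ker, hs, Fintype.sum_sigma]
    simp only [divL, LinearMap.coe_mk, AddHom.coe_mk, Finset.sum_sub_distrib]
    rw [sum_shift (fun i => ∑ a : Fin (w i), ∑ b : Fin (w (i + 1)), c ⟨i, (a, b)⟩), sub_eq_zero]
    exact Finset.sum_congr rfl fun i _ => by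
      rw [Finset.sum_comm]
  have hfr := Submodule.finrank_mono hle
  rw [hsurj, finrank_top, Module.finrank_self] at hsn
  have cE : Module.finrank ℂ ((Σ i : Fin d, Edge w i) → ℂ) = ∑ i : Fin d, w i * w (i + 1) := by
    rw [Module.finrank_fintype_fun_eq_card]
    simp [Fintype.card_sigma]
  have cV : Module.finrank ℂ ((Σ i : Fin d, Fin (w (i + 1))) → ℂ) = ∑ i : Fin d, w i := by
    rw [Module.finrank_fintype_fun_eq_card, ← sum_shift w]
    simp [Fintype.card_sigma]
  rw [cE] at hrn
  rw [cV] at hsn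
  have hEV : ∑ i : Fin d, w i ≤ ∑ i : Fin d, w i * w (i + 1) :=
    Finset.sum_le_sum fun i _ => Nat.le_mul_of_pos_right _ (by have := hw (i + 1); omega)
  omega

end ABPaux

theorem rho_image_of_psi_span (d : ℕ) [NeZero d] (hd3 : 3 ≤ d) (hodd : Odd d)
    (w : Fin d → ℕ) (hw : ∀ i, 2 ≤ w i) :
    ABP.rho w '' ↑(Submodule.span ℂ
        (Set.range fun x : Σ i : Fin d, ABP.Edge w i => ABP.psi w x.1 x.2)) =
      {c : (Σ i : Fin d, ABP.Edge w i) → ℂ | ABP.IsFlow w c} ∧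
    (∑ i : Fin d, w i * w (i + 1)) - (∑ i : Fin d, w i) + 1 ≤
      Module.finrank ℂ (Submodule.span ℂ
        (Set.range fun x : Σ i : Fin d, ABP.Edge w i => ABP.psi w x.1 x.2)) := by
  have hm := ABPaux.map_eq hd3 w hw
  constructor
  · ext c
    rw [Set.mem_ofPred_eq, ← ABPaux.mem_ker_divL, ← hm]
    rfl
  · refine (ABPaux.dim_flow w hw).trans ?_
    rw [← hm]
    exact Submodule.finrank_map_le _ _
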